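/- For every non-negative integer n and every integer k, (−1)^k · 2 · ∑_{j=0}^{n} G_{j+k}·G_{j−k} = (L_k² − 2·F_{k−1}·F_{k+1} − 2·F_k²)·(G_n·G_{n+1} − G_0·G_1 + G_0²) − F_k²·(G_{n−1}·G_{n+2} − 2·G_0·G_1 + G_1²). -/

import Mathlib

/-- A two-sided Fibonacci-like sequence vanishing at `0` and `1` is zero. -/
theorem fibLike_eq_zero (H : ℤ → ℤ) (h0 : H 0 = 0) (h1 : H 1 = 0)
    (hH : ∀ j : ℤ, H j = H (j - 1) + H (j - 2)) (k : ℤ) : H k = 0 := by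
  suffices h : H k = 0 ∧ H (k + 1) = 0 from h.1
  induction k using Int.induction_on with
  | zero => exact ⟨h0, by simpa using h1⟩
  | succ i ih =>
    refine ⟨ih.2, ?_⟩
    have h := hH ((i : ℤ) + 1 + 1)
    rw [show (i : ℤ) + 1 + 1 - 1 = i + 1 by ring, show (i : ℤ) + 1 + 1 - 2 = i by ring] at h
    rw [h, ih.1, ih.2, add_zero]
  | pred i ih =>
    have h := hH (-(i : ℤ) + 1)
    rw [show -(i : ℤ) + 1 - 1 = -i by ring, show -(i : ℤ) + 1 - 2 = -i - 1 by ring] at h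
    rw [sub_add_cancel]
    exact ⟨by linarith [ih.1, ih.2], ih.1⟩

theorem neg_one_pow_natAbs_sub_one (k : ℤ) :
    (-1 : ℤ) ^ (k - 1).natAbs = -(-1) ^ k.natAbs := by
  rcases Int.even_or_odd k with h | h
  · have h' : Odd (k - 1) := h.sub_odd odd_one
    rw [(Int.natAbs_even.mpr h).neg_one_pow, (Int.natAbs_odd.mpr h').neg_one_pow]
  · have h' : Even (k - 1) := h.sub_odd odd_one
    rw [(Int.natAbs_odd.mpr h).neg_one_pow, (Int.natAbs_even.mpr h').neg_one_pow, neg_neg]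

theorem fibLike_add (F G : ℤ → ℤ) (hF0 : F 0 = 0) (hF1 : F 1 = 1)
    (hF : ∀ j : ℤ, F j = F (j - 1) + F (j - 2))
    (hG : ∀ j : ℤ, G j = G (j - 1) + G (j - 2)) (j k : ℤ) :
    G (j + k) = F (k - 1) * G j + F k * G (j + 1) := by
  have hm : F (-1) = 1 := by
    have h := hF 1
    norm_num at h
    linarith
  have h := fibLike_eq_zero (fun k => G (j + k) - (F (k - 1) * G j + F k * G (j + 1)))
    (by simp [hF0, hm]) (by simp [hF0, hF1]) (fun k => by
      have e₁ := hG (j + k)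
      have e₂ := hF k
      have e₃ := hF (k - 1)
      rw [show j + k - 1 = j + (k - 1) by ring, show j + k - 2 = j + (k - 2) by ring] at e₁
      rw [show k - 1 - 2 = k - 2 - 1 by ring] at e₃
      linear_combination e₁ - G j * e₃ - G (j + 1) * e₂) k
  exact sub_eq_zero.mp h

theorem neg_one_pow_mul_fibLike_sub (F G : ℤ → ℤ) (hF0 : F 0 = 0) (hF1 : F 1 = 1)
    (hF : ∀ j : ℤ, F j = F (j - 1) + F (j - 2))
    (hG : ∀ j : ℤ, G j = G (j - 1) + G (j - 2)) (j k : ℤ) :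
    (-1) ^ k.natAbs * G (j - k) = F (k + 1) * G j - F k * G (j + 1) := by
  have hF2 : F 2 = 1 := by
    have h := hF 2
    norm_num [hF0, hF1] at h
    exact h
  have hGj := hG (j + 1)
  rw [show j + 1 - 1 = j by ring, show j + 1 - 2 = j - 1 by ring] at hGj
  have h := fibLike_eq_zero
    (fun k => (-1) ^ k.natAbs * G (j - k) - (F (k + 1) * G j - F k * G (j + 1)))
    (by simp [hF0, hF1]) (by norm_num [hF1, hF2]; linarith) (fun k => by
      have e₁ := hG (j - (k - 2))
      have e₂ := hF k
      have e₃ := hF (k + 1)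
      have s₁ := neg_one_pow_natAbs_sub_one k
      have s₂ := neg_one_pow_natAbs_sub_one (k - 1)
      rw [show k - 1 - 1 = k - 2 by ring, s₁, neg_neg] at s₂
      rw [show j - (k - 2) - 1 = j - (k - 1) by ring, show j - (k - 2) - 2 = j - k by ring] at e₁
      rw [show k + 1 - 1 = k - 1 + 1 by ring, show k + 1 - 2 = k - 2 + 1 by ring] at e₃
      simp only [s₁, s₂]
      linear_combination -(-1) ^ k.natAbs * e₁ - G j * e₃ + G (j + 1) * e₂) k
  exact sub_eq_zero.mp h


/-- For every non-negative integer `n` and integer `k`,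
`(-1)^k 2 ∑_{j=0}^n G_{j+k} G_{j-k}
  = (L_k² - 2 F_{k-1} F_{k+1} - 2 F_k²)(G_n G_{n+1} - G_0 G_1 + G_0²)
  - F_k² (G_{n-1} G_{n+2} - 2 G_0 G_1 + G_1²)`. -/
theorem stmt_17 (F L G : ℤ → ℤ)
    (hF0 : F 0 = 0) (hF1 : F 1 = 1)
    (hF : ∀ j : ℤ, F j = F (j - 1) + F (j - 2))
    (hL0 : L 0 = 2) (hL1 : L 1 = 1)
    (hL : ∀ j : ℤ, L j = L (j - 1) + L (j - 2))
    (hG : ∀ j : ℤ, G j = G (j - 1) + G (j - 2))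
    (n : ℕ) (k : ℤ) :
    (-1 : ℤ) ^ k.natAbs * 2 * ∑ j ∈ Finset.range (n + 1), G ((j : ℤ) + k) * G ((j : ℤ) - k) =
      (L k ^ 2 - 2 * F (k - 1) * F (k + 1) - 2 * F k ^ 2)
        * (G n * G ((n : ℤ) + 1) - G 0 * G 1 + G 0 ^ 2)
      - F k ^ 2 * (G ((n : ℤ) - 1) * G ((n : ℤ) + 2) - 2 * G 0 * G 1 + G 1 ^ 2) := by
  have hLF : L k = F k + 2 * F (k - 1) := by
    have h := fibLike_add F L hF0 hF1 hF hL 0 k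
    rw [zero_add, zero_add, hL0, hL1] at h
    linarith
  have hFk : F (k + 1) = F k + F (k - 1) := by
    have h := hF (k + 1)
    rwa [show k + 1 - 1 = k by ring, show k + 1 - 2 = k - 1 by ring] at h
  have hprod (j : ℤ) : (-1 : ℤ) ^ k.natAbs * 2 * (G (j + k) * G (j - k)) =
      2 * (F (k - 1) * G j + F k * G (j + 1)) * ((F k + F (k - 1)) * G j - F k * G (j + 1)) := by
    have h := neg_one_pow_mul_fibLike_sub F G hF0 hF1 hF hG j k
    rw [hFk] at h
    rw [fibLike_add F G hF0 hF1 hF hG j k]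
    linear_combination 2 * (F (k - 1) * G j + F k * G (j + 1)) * h
  have hprev (j : ℤ) : G (j - 1) = G (j + 1) - G j := by
    have h := hG (j + 1)
    rw [show j + 1 - 1 = j by ring, show j + 1 - 2 = j - 1 by ring] at h
    linarith
  have hnext (j : ℤ) : G (j + 2) = G (j + 1) + G j := by
    have h := hG (j + 2)
    rwa [show j + 2 - 1 = j + 1 by ring, show j + 2 - 2 = j by ring] at h
  rw [hLF, hFk]
  induction n with
  | zero =>
    rw [Finset.sum_range_one, hprod, hprev, hnext]
    simp only [Nat.cast_zero, zero_add]
    ring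
  | succ n ih =>
    rw [Finset.sum_range_succ, mul_add, ih, hprod, hprev, hprev, hnext, hnext]
    push_cast
    rw [show (n : ℤ) + 1 + 1 = n + 2 by ring, hnext]
    ring
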